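/- For every x ∈ V_{θ_s}^0 lying outside the union of the hyperplanes H_μ over all short roots μ, the stabilizer subalgebra 𝔤_x = {y ∈ 𝔤 : y·x = 0} equals 𝔥 = 𝔱 ⊕ (⊕_{μ∈Δ_l} 𝔤^μ), and 𝔤·x = ⊕_{μ∈Δ_s} V_{θ_s}^μ; in particular V_{θ_s} = V_{θ_s}^0 ⊕ 𝔤·x. -/

import Mathlib

open scoped RealInnerProductSpace

/-- The orthogonal reflection of a Euclidean space in the hyperplane orthogonal to `α`. -/
noncomputable def rrefl {E : Type} [NormedAddCommGroup E] [InnerProductSpace ℝ E]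
    [FiniteDimensional ℝ E] (α : E) : E ≃ₗᵢ[ℝ] E :=
  Submodule.reflection ((ℝ ∙ α)ᗮ)

/-- The `χ`-weight space of the `L`-module `M` with respect to the subalgebra `H`:
`{v : M | ∀ x ∈ H, x · v = χ(x) • v}`.  With `M := L` (adjoint action) and `χ = e μ` this is
the root space `𝔤^μ`. -/
def hwt {L : Type} [LieRing L] [LieAlgebra ℂ L] (H : LieSubalgebra ℂ L)
    (M : Type) [AddCommGroup M] [Module ℂ M] [LieRingModule L M] [LieModule ℂ L M]
    (χ : H → ℂ) : Submodule ℂ M where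
  carrier := {v | ∀ x : H, ⁅(x : L), v⁆ = χ x • v}
  add_mem' := by
    intro a b ha hb x
    rw [lie_add, ha x, hb x, smul_add]
  zero_mem' := by
    intro x
    rw [lie_zero, smul_zero]
  smul_mem' := by
    intro c v hv x
    rw [lie_smul, hv x, smul_comm]

/-- The action of `x ∈ L` on the module `M`, as a linear map `M →ₗ M`. -/
def adm (L : Type) [LieRing L] [LieAlgebra ℂ L]
    (M : Type) [AddCommGroup M] [Module ℂ M] [LieRingModule L M] [LieModule ℂ L M]
    (x : L) : M →ₗ[ℂ] M where
  toFun v := ⁅x, v⁆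
  map_add' a b := lie_add x a b
  map_smul' c v := lie_smul c x v

/-- For `v ∈ M`, the linear map `L → M`, `y ↦ y · v`; its range is `𝔤·v` and its kernel is
the stabiliser of `v` in `L`. -/
def actOn (L : Type) [LieRing L] [LieAlgebra ℂ L]
    (M : Type) [AddCommGroup M] [Module ℂ M] [LieRingModule L M] [LieModule ℂ L M]
    (v : M) : L →ₗ[ℂ] M where
  toFun y := ⁅y, v⁆
  map_add' a b := add_lie a b v
  map_smul' c y := smul_lie c y v



set_option linter.unusedSectionVars false

section Euclid
variable {E : Type} [NormedAddCommGroup E] [InnerProductSpace ℝ E] [FiniteDimensional ℝ E]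

lemma rrefl_eq (α β : E) : rrefl α β = β - (2 * ⟪β, α⟫ / ⟪α, α⟫) • α := by
  unfold rrefl
  rw [Submodule.reflection_orthogonal_apply, Submodule.reflection_singleton_apply,
    real_inner_comm, real_inner_self_eq_norm_sq]
  simp only [RCLike.ofReal_real_eq_id, id_eq, neg_sub]
  congr 1
  rw [two_smul, ← add_smul]
  congr 1
  ring

lemma root_add {Δ : Set E} (h0 : (0 : E) ∉ Δ)
    (hrefl : ∀ α ∈ Δ, ∀ β ∈ Δ, rrefl α β ∈ Δ)
    (hcrys : ∀ α ∈ Δ, ∀ β ∈ Δ, ∃ n : ℤ, 2 * ⟪β, α⟫ / ⟪α, α⟫ = (n : ℝ))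
    {a b : E} (ha : a ∈ Δ) (hb : b ∈ Δ) (hab : ⟪a, b⟫ < 0) : a + b = 0 ∨ a + b ∈ Δ := by
  have ha0 : a ≠ 0 := fun h => h0 (h ▸ ha)
  have hb0 : b ≠ 0 := fun h => h0 (h ▸ hb)
  have haa : 0 < ⟪a, a⟫ := real_inner_self_pos.2 ha0
  have hbb : 0 < ⟪b, b⟫ := real_inner_self_pos.2 hb0
  obtain ⟨p, hp⟩ := hcrys b hb a ha
  obtain ⟨q, hq⟩ := hcrys a ha b hb
  have h1 := hrefl b hb a ha
  have h2 := hrefl a ha b hb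
  rw [rrefl_eq, hp] at h1
  rw [rrefl_eq, hq] at h2
  rw [real_inner_comm] at hq
  by_cases hp1 : p = -1
  · right; rw [hp1] at h1; simpa using h1
  by_cases hq1 : q = -1
  · right; rw [hq1] at h2; simpa [add_comm] using h2
  left
  have hpn : (p : ℝ) < 0 := by rw [← hp]; exact div_neg_of_neg_of_pos (by linarith) hbb
  have hqn : (q : ℝ) < 0 := by rw [← hq]; exact div_neg_of_neg_of_pos (by linarith) haa
  have hp2 : p ≤ -2 := by have : p < 0 := by exact_mod_cast hpn
                          omega
  have hq2 : q ≤ -2 := by have : q < 0 := by exact_mod_cast hqn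
                          omega
  have hp3 : (p : ℝ) ≤ -2 := by exact_mod_cast hp2
  have hq3 : (q : ℝ) ≤ -2 := by exact_mod_cast hq2
  rw [← hp, div_le_iff₀ hbb] at hp3
  rw [← hq, div_le_iff₀ haa] at hq3
  have h3 : ⟪a + b, a + b⟫ ≤ 0 := by
    rw [inner_add_left, inner_add_right, inner_add_right, real_inner_comm a b]
    linarith
  exact inner_self_eq_zero.1 (le_antisymm h3 real_inner_self_nonneg)

lemma short_lattice {Δ : Set E} (h0 : (0 : E) ∉ Δ)
    (hrefl : ∀ α ∈ Δ, ∀ β ∈ Δ, rrefl α β ∈ Δ)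
    (hcrys : ∀ α ∈ Δ, ∀ β ∈ Δ, ∃ n : ℤ, 2 * ⟪β, α⟫ / ⟪α, α⟫ = (n : ℝ))
    (ls : ℝ) (h0ls : 0 < ls) (hls : ∀ α ∈ Δ, ls ≤ ‖α‖) (n : ℕ) :
    ∀ s : Multiset E, s.card = n → (∀ a ∈ s, a ∈ Δ) → ‖s.sum‖ ≤ ls →
      s.sum = 0 ∨ s.sum ∈ Δ := by
  induction n using Nat.strong_induction_on with
  | _ n ih =>
  intro s hcard hs hnorm
  induction s using Multiset.induction_on with
  | empty => left; simp
  | cons a t _ =>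
    have ha : a ∈ Δ := hs a (by simp)
    by_cases hneg : ∃ b ∈ t, ⟪a, b⟫ < 0
    · obtain ⟨b, hbt, hab⟩ := hneg
      obtain ⟨u, rfl⟩ := Multiset.exists_cons_of_mem hbt
      have hb : b ∈ Δ := hs b (by simp)
      have hu : ∀ c ∈ u, c ∈ Δ := fun c hc => hs c (by simp [hc])
      simp only [Multiset.card_cons] at hcard
      have hsum : (a ::ₘ b ::ₘ u).sum = (a + b) + u.sum := by simp [add_assoc]
      rw [hsum] at hnorm ⊢
      rcases root_add h0 hrefl hcrys ha hb hab with h | h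
      · rw [h, zero_add] at hnorm ⊢
        exact ih u.card (by omega) u rfl hu hnorm
      · have := ih (u.card + 1) (by omega) ((a + b) ::ₘ u) (by simp)
          (by intro c hc; rcases Multiset.mem_cons.1 hc with rfl | hc
              · exact h
              · exact hu c hc)
          (by simpa using hnorm)
        simpa using this
    · push Not at hneg
      right
      have hin : ∀ t : Multiset E, (∀ b ∈ t, 0 ≤ ⟪a, b⟫) → 0 ≤ ⟪a, t.sum⟫ := by
        intro t
        induction t using Multiset.induction_on with
        | empty => simp
        | cons c r ihr =>
          intro h
          rw [Multiset.sum_cons, inner_add_right]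
          exact add_nonneg (h c (by simp)) (ihr fun b hb => h b (by simp [hb]))
      have h1 := hin t hneg
      rw [Multiset.sum_cons] at hnorm ⊢
      have h2 := norm_add_sq_real a t.sum
      have h3 := hls a ha
      have h4 : ‖a + t.sum‖ ^ 2 ≤ ls ^ 2 := by gcongr
      have h5 : ls ^ 2 ≤ ‖a‖ ^ 2 := by gcongr
      have h6 : ‖t.sum‖ ^ 2 = 0 := le_antisymm (by linarith) (sq_nonneg _)
      have h7 : t.sum = 0 := by simpa using h6
      rw [h7, add_zero]; exact ha

lemma exists_height {Φ : Set E} (hΦind : LinearIndependent ℝ (fun a : Φ => (a : E))) :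
    ∃ f : E →ₗ[ℝ] ℝ, ∀ α ∈ Φ, f α = 1 := by
  have h : LinearIndepOn ℝ id Φ := hΦind
  let B := Module.Basis.extend h
  refine ⟨B.constr ℝ (fun _ => (1 : ℝ)), fun α hα => ?_⟩
  have h2 : α = B ⟨α, h.subset_extend _ hα⟩ := by simp [B]
  conv_lhs => rw [h2]
  rw [Module.Basis.constr_basis]

end Euclid

section LieP
open LieAlgebra LieModule
variable {L : Type} [LieRing L] [LieAlgebra ℂ L] {H : LieSubalgebra ℂ L}
    {M : Type} [AddCommGroup M] [Module ℂ M] [LieRingModule L M] [LieModule ℂ L M]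

lemma hwt_lie {χ ψ : H → ℂ} {y : L} {w : M} (hy : y ∈ hwt H L χ) (hw : w ∈ hwt H M ψ) :
    ⁅y, w⁆ ∈ hwt H M (χ + ψ) := by
  intro x
  have h1 : ⁅(x : L), y⁆ = χ x • y := hy x
  have h2 : ⁅(x : L), w⁆ = ψ x • w := hw x
  rw [leibniz_lie, h1, h2, smul_lie, lie_smul, Pi.add_apply, add_smul]

lemma hwt_indep [LieRing.IsNilpotent H] : iSupIndep (fun χ : H → ℂ => hwt H M χ) := by
  have h := LieModule.iSupIndep_genWeightSpace ℂ H M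
  rw [← LieSubmodule.iSupIndep_toSubmodule] at h
  refine h.mono fun χ => ?_
  intro v hv
  exact LieModule.weightSpace_le_genWeightSpace M χ ((LieModule.mem_weightSpace χ v).2 hv)

lemma sl2_inj {h x y : L} (t : IsSl2Triple h x y) {w : M} (hw : w ≠ 0) (n : ℕ)
    (hh : ⁅h, w⁆ = (-(n : ℂ)) • w) (hy : ⁅y, w⁆ = 0) : ((toEnd ℂ L M x) ^ n) w ≠ 0 := by
  have P : t.symm.HasPrimitiveVectorWith w (n : ℂ) :=
    ⟨hw, by rw [neg_lie, hh, neg_smul, neg_neg], hy⟩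
  exact P.pow_toEnd_f_ne_zero_of_eq_nat rfl le_rfl

variable [FiniteDimensional ℂ L] [LieAlgebra.IsSimple ℂ L] [H.IsCartanSubalgebra]

lemma hwt_eq (χ : H → ℂ) : hwt H L χ = (rootSpace H χ).toSubmodule := by
  apply le_antisymm
  · intro v hv
    exact LieModule.weightSpace_le_genWeightSpace L χ ((LieModule.mem_weightSpace χ v).2 hv)
  · intro v hv x
    exact LieAlgebra.IsKilling.lie_eq_smul_of_mem_rootSpace hv x

lemma hwt_zero_eq : hwt H L (0 : H → ℂ) = H.toSubmodule := by
  rw [hwt_eq, rootSpace_zero_eq]; rfl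

lemma hwt_top : ⨆ χ : H → ℂ, hwt H L χ = ⊤ := by
  have h := LieModule.iSup_genWeightSpace_eq_top ℂ H L
  simp only [← LieSubmodule.toSubmodule_inj, LieSubmodule.iSup_toSubmodule] at h
  simp_rw [hwt_eq]
  exact h

lemma hwt_sl2 {a : H → ℂ} (ha0 : a ≠ 0) (ha : hwt H L a ≠ ⊥) :
    ∃ c : H, ∃ x ∈ hwt H L a, ∃ y ∈ hwt H L (-a), IsSl2Triple (c : L) x y ∧ a c = 2 ∧
      ∀ b : H → ℂ, b ≠ 0 → hwt H L b ≠ ⊥ →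
        ∃ n : ℤ, b c = n ∧ hwt H L (b - n • a) ≠ ⊥ ∧ b - n • a ≠ 0 := by
  have conv : ∀ b : H → ℂ, hwt H L b ≠ ⊥ → rootSpace H b ≠ ⊥ := by
    intro b hb h; apply hb; rw [hwt_eq, h]; rfl
  let A : Weight ℂ H L := ⟨a, conv a ha⟩
  have hA : A.IsNonZero := fun h => ha0 h
  obtain ⟨h, x, y, t, hx, hy⟩ := IsKilling.exists_isSl2Triple_of_weight_isNonZero hA
  have hc := t.h_eq_coroot hA hx hy
  refine ⟨IsKilling.coroot A, x, by rw [hwt_eq]; exact hx, y, by rw [hwt_eq]; exact hy,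
    hc ▸ t, IsKilling.root_apply_coroot hA, ?_⟩
  intro b hb0 hb
  let B : Weight ℂ H L := ⟨b, conv b hb⟩
  have hB : B.IsNonZero := fun h => hb0 h
  have h1 := IsKilling.apply_coroot_eq_cast A B
  refine ⟨_, h1, ?_⟩
  have h2 : b - ((chainBotCoeff A B - chainTopCoeff A B : ℤ)) • a = IsKilling.reflectRoot A B := by
    change _ = (B : H → ℂ) - B (IsKilling.coroot A) • (A : H → ℂ)
    rw [h1, Int.cast_smul_eq_zsmul]; rfl
  rw [h2]
  constructor
  · rw [hwt_eq]
    intro h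
    exact (IsKilling.reflectRoot A B).genWeightSpace_ne_bot' ((LieSubmodule.toSubmodule_eq_bot _).1 h)
  · exact IsKilling.reflectRoot_isNonZero A B hB

end LieP

section Core
variable {E : Type} [NormedAddCommGroup E] [InnerProductSpace ℝ E] [FiniteDimensional ℝ E]

lemma pr_int {Δ : Set E}
    (hcrys : ∀ α ∈ Δ, ∀ β ∈ Δ, ∃ n : ℤ, 2 * ⟪β, α⟫ / ⟪α, α⟫ = (n : ℝ))
    {α l : E} (hα : α ∈ Δ) (hl : l ∈ AddSubmonoid.closure Δ) :
    ∃ n : ℤ, 2 * ⟪l, α⟫ / ⟪α, α⟫ = (n : ℝ) := by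
  induction hl using AddSubmonoid.closure_induction with
  | mem x hx => exact hcrys α hα x hx
  | zero => exact ⟨0, by simp⟩
  | add x y _ _ hx hy =>
    obtain ⟨n, hn⟩ := hx
    obtain ⟨m, hm⟩ := hy
    refine ⟨n + m, ?_⟩
    rw [inner_add_left, mul_add, add_div, hn, hm]; push_cast; rfl

lemma pr_neg_nat {Δ : Set E} (h0 : (0 : E) ∉ Δ)
    (hcrys : ∀ α ∈ Δ, ∀ β ∈ Δ, ∃ n : ℤ, 2 * ⟪β, α⟫ / ⟪α, α⟫ = (n : ℝ))
    {α l : E} (hα : α ∈ Δ) (hl : l ∈ AddSubmonoid.closure Δ) (hneg : ⟪l, α⟫ < 0) :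
    ∃ n : ℕ, 0 < n ∧ 2 * ⟪l, α⟫ / ⟪α, α⟫ = -(n : ℝ) := by
  obtain ⟨m, hm⟩ := pr_int hcrys hα hl
  have haa : 0 < ⟪α, α⟫ := real_inner_self_pos.2 (fun h => h0 (h ▸ hα))
  have h1 : (m : ℝ) < 0 := by rw [← hm]; exact div_neg_of_neg_of_pos (by linarith) haa
  have h2 : m < 0 := by exact_mod_cast h1
  refine ⟨m.natAbs, by omega, ?_⟩
  have h3 : m = -(m.natAbs : ℤ) := by omega
  have h4 : (m : ℝ) = ((-(m.natAbs : ℤ) : ℤ) : ℝ) := congrArg _ h3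
  rw [hm, h4, Int.cast_neg, Int.cast_natCast]

lemma norm_sub_gt {α l : E} (hneg : ⟪l, α⟫ < 0) :
    ‖l‖ < ‖l - α‖ := by
  have h1 := norm_sub_sq_real l α
  have h2 : 0 ≤ ‖α‖ ^ 2 := sq_nonneg _
  refine lt_of_pow_lt_pow_left₀ 2 (norm_nonneg _) ?_
  linarith

lemma core {Δ Φ : Set E} (hfin : Δ.Finite) (h0 : (0 : E) ∉ Δ)
    (hrefl : ∀ α ∈ Δ, ∀ β ∈ Δ, rrefl α β ∈ Δ)
    (hcrys : ∀ α ∈ Δ, ∀ β ∈ Δ, ∃ n : ℤ, 2 * ⟪β, α⟫ / ⟪α, α⟫ = (n : ℝ))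
    (hΦ : Φ ⊆ Δ) (f : E →ₗ[ℝ] ℝ) (hf : ∀ α ∈ Φ, f α = 1)
    (ls : ℝ) (h0ls : 0 < ls) (hls : ∀ α ∈ Δ, ls ≤ ‖α‖)
    (θ : E) (hθ : ‖θ‖ = ls)
    (hdom : ∀ γ ∈ Δ, ‖γ‖ = ls → ∀ μ : E, (∀ α ∈ Φ, 0 ≤ ⟪μ, α⟫) → 0 ≤ ⟪μ, θ - γ⟫)
    (d : E → ℕ) (hdfin : {l | d l ≠ 0}.Finite)
    (hlat : ∀ l, d l ≠ 0 → l ∈ AddSubmonoid.closure Δ)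
    (hdomd : ∀ l, d l ≠ 0 → ∀ μ : E, (∀ α ∈ Φ, 0 ≤ ⟪μ, α⟫) → 0 ≤ ⟪μ, θ - l⟫)
    (hstep : ∀ α ∈ Φ, ∀ l ∈ AddSubmonoid.closure Δ, d (l - α) = 0 → ∀ n : ℕ,
      2 * ⟪l, α⟫ / ⟪α, α⟫ = -(n : ℝ) → d l ≤ d (l + (n : ℝ) • α))
    (hdθ : d θ ≤ 1) :
    (∀ l, d l ≠ 0 → l = 0 ∨ (l ∈ Δ ∧ ‖l‖ = ls)) ∧ (∀ γ ∈ Δ, ‖γ‖ = ls → d γ ≤ 1) := by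
  have hrr : ∀ α l : E, ∀ n : ℕ, 2 * ⟪l, α⟫ / ⟪α, α⟫ = -(n : ℝ) →
      rrefl α l = l + (n : ℝ) • α := by
    intro α l n hn
    rw [rrefl_eq, hn, neg_smul, sub_neg_eq_add]
  have hbound : ∀ l, d l ≠ 0 → ‖l‖ ≤ ls := by
    intro l0 hl0
    obtain ⟨l1, hl1, hmax1⟩ := Set.exists_max_image {l | d l ≠ 0} (fun l => ‖l‖) hdfin ⟨l0, hl0⟩
    obtain ⟨l, ⟨hl, hln⟩, hmax⟩ := Set.exists_max_image {l | d l ≠ 0 ∧ ‖l‖ = ‖l1‖} (fun l => f l)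
      (hdfin.subset fun x hx => hx.1) ⟨l1, hl1, rfl⟩
    have hd : ∀ α ∈ Φ, 0 ≤ ⟪l, α⟫ := by
      intro α hα
      by_contra hneg
      push Not at hneg
      obtain ⟨n, hn, hpr⟩ := pr_neg_nat h0 hcrys (hΦ hα) (hlat l hl) hneg
      have h1 : d (l - α) = 0 := by
        by_contra h
        have := hmax1 _ h
        have h2 := norm_sub_gt hneg
        linarith
      have h2 := hstep α hα l (hlat l hl) h1 n hpr
      have h3 : d (l + (n : ℝ) • α) ≠ 0 := fun h => hl (by omega)
      have h4 : ‖l + (n : ℝ) • α‖ = ‖l1‖ := by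
        rw [← hrr α l n hpr, LinearIsometryEquiv.norm_map, hln]
      have h5 := hmax _ ⟨h3, h4⟩
      simp only [map_add, map_smul, hf α hα, smul_eq_mul, mul_one] at h5
      have : (0 : ℝ) < n := by exact_mod_cast hn
      linarith
    have h1 := hdomd l hl l hd
    rw [inner_sub_right, real_inner_self_eq_norm_sq] at h1
    have h2 := real_inner_le_norm l θ
    rw [hθ] at h2
    have h3 : ‖l‖ ≤ ls := by
      by_contra h
      push Not at h
      nlinarith [norm_nonneg l]
    have h4 := hmax1 _ hl0
    linarith
  constructor
  · intro l hl
    obtain ⟨s, hs, rfl⟩ := AddSubmonoid.exists_multiset_of_mem_closure (hlat l hl)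
    rcases short_lattice h0 hrefl hcrys ls h0ls hls _ s rfl hs (hbound _ hl) with h | h
    · exact Or.inl h
    · exact Or.inr ⟨h, le_antisymm (hbound _ hl) (hls _ h)⟩
  · by_contra hbad
    push Not at hbad
    obtain ⟨γ, hγ, hγn, hγd⟩ := hbad
    obtain ⟨l, ⟨hl, hln, hld⟩, hmax⟩ := Set.exists_max_image {l | l ∈ Δ ∧ ‖l‖ = ls ∧ 1 < d l}
      (fun l => f l) (hfin.subset fun x hx => hx.1) ⟨γ, hγ, hγn, hγd⟩
    have hd : ∀ α ∈ Φ, 0 ≤ ⟪l, α⟫ := by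
      intro α hα
      by_contra hneg
      push Not at hneg
      have hlc : l ∈ AddSubmonoid.closure Δ := AddSubmonoid.subset_closure hl
      obtain ⟨n, hn, hpr⟩ := pr_neg_nat h0 hcrys (hΦ hα) hlc hneg
      have h1 : d (l - α) = 0 := by
        by_contra h
        have := hbound _ h
        have h2 := norm_sub_gt hneg
        linarith
      have h2 := hstep α hα l hlc h1 n hpr
      have h4 : ‖l + (n : ℝ) • α‖ = ls := by
        rw [← hrr α l n hpr, LinearIsometryEquiv.norm_map, hln]
      have h6 : l + (n : ℝ) • α ∈ Δ := by
        rw [← hrr α l n hpr]; exact hrefl α (hΦ hα) l hl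
      have h5 := hmax _ ⟨h6, h4, by omega⟩
      simp only [map_add, map_smul, hf α hα, smul_eq_mul, mul_one] at h5
      have : (0 : ℝ) < n := by exact_mod_cast hn
      linarith
    have h1 := hdom l hl hln l hd
    rw [inner_sub_right, real_inner_self_eq_norm_sq] at h1
    have h2 := norm_sub_sq_real l θ
    rw [hθ, hln] at h2
    rw [hln] at h1
    have h3 : ‖l - θ‖ ^ 2 = 0 := le_antisymm (by linarith) (sq_nonneg _)
    have h4 : l = θ := by
      have : l - θ = 0 := by simpa using h3
      exact sub_eq_zero.1 this
    rw [h4] at hld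
    omega

lemma pair_match {Δ : Set E} (hfin : Δ.Finite) (h0 : (0 : E) ∉ Δ)
    (hrefl : ∀ α ∈ Δ, ∀ β ∈ Δ, rrefl α β ∈ Δ)
    (hcrys : ∀ α ∈ Δ, ∀ β ∈ Δ, ∃ n : ℤ, 2 * ⟪β, α⟫ / ⟪α, α⟫ = (n : ℝ))
    {X : Type} (e : E →+ (X → ℂ)) (α : E) (hα : α ∈ Δ) (c : X) (h2 : e α c = 2)
    (hc : ∀ β ∈ Δ, ∃ n : ℤ, e β c = n ∧ β - n • α ∈ Δ) :
    ∀ l ∈ AddSubmonoid.closure Δ, e l c = ((2 * ⟪l, α⟫ / ⟪α, α⟫ : ℝ) : ℂ) := by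
  have hα0 : α ≠ 0 := fun h => h0 (h ▸ hα)
  have haa : ⟪α, α⟫ ≠ 0 := (real_inner_self_pos.2 hα0).ne'
  have key : ∀ β ∈ Δ, e β c = ((2 * ⟪β, α⟫ / ⟪α, α⟫ : ℝ) : ℂ) := by
    intro β hβ
    obtain ⟨n, hn⟩ := hcrys α hα β hβ
    obtain ⟨m, hm, -⟩ := hc β hβ
    have hall : ∀ k : ℕ, β + ((k : ℤ) * (n - m)) • α ∈ Δ := by
      intro k
      induction k with
      | zero => simpa using hβ
      | succ k ih =>
        have h3 := hrefl α hα _ ih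
        have h4 : 2 * ⟪β + ((k : ℤ) * (n - m)) • α, α⟫ / ⟪α, α⟫
            = ((n + 2 * ((k : ℤ) * (n - m)) : ℤ) : ℝ) := by
          rw [inner_add_left, mul_add, add_div, hn, ← Int.cast_smul_eq_zsmul ℝ,
            real_inner_smul_left]
          push_cast
          field_simp
        rw [rrefl_eq, h4, Int.cast_smul_eq_zsmul] at h3
        obtain ⟨p, hp, hp'⟩ := hc _ h3
        rw [map_sub, map_add, map_zsmul, map_zsmul] at hp
        simp only [Pi.add_apply, Pi.sub_apply, Pi.smul_apply, hm, h2] at hp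
        simp only [zsmul_eq_mul] at hp
        have hp2 : p = m + (k : ℤ) * (n - m) * 2 - (n + 2 * ((k : ℤ) * (n - m))) * 2 := by
          exact_mod_cast hp.symm
        convert hp' using 1
        rw [hp2, add_sub_assoc, add_sub_assoc, ← sub_smul, ← sub_smul]
        congr 2
        push_cast
        ring
    have hnm : n = m := by
      by_contra hne
      have hinj : Function.Injective (fun k : ℕ => β + ((k : ℤ) * (n - m)) • α) := by
        intro k k' hk
        have h5 := add_left_cancel hk
        simp only [← Int.cast_smul_eq_zsmul ℝ] at h5
        have h6 : (k : ℤ) * (n - m) = (k' : ℤ) * (n - m) := by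
          exact_mod_cast smul_left_injective ℝ hα0 h5
        have h7 := mul_right_cancel₀ (sub_ne_zero.2 hne) h6
        exact_mod_cast h7
      exact (Set.infinite_range_of_injective hinj).mono
        (by rintro _ ⟨k, rfl⟩; exact hall k) hfin
    rw [hn, hm, hnm]; push_cast; rfl
  intro l hl
  induction hl using AddSubmonoid.closure_induction with
  | mem x hx => exact key x hx
  | zero => simp
  | add x y _ _ hx hy =>
    rw [map_add, Pi.add_apply, hx, hy, inner_add_left, mul_add, add_div]
    push_cast; rfl

end Core

section Gen
variable {L : Type} [LieRing L] [LieAlgebra ℂ L]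
    {M : Type} [AddCommGroup M] [Module ℂ M] [LieRingModule L M] [LieModule ℂ L M]

lemma gen_top (hMsimple : ∀ N : LieSubmodule ℂ L M, N = ⊥ ∨ N = ⊤) (K : Submodule ℂ M)
    (nm : Set L) (v : M) (hv0 : v ≠ 0) (hvK : v ∈ K)
    (hv : ∀ S : Submodule ℂ M, v ∈ S → (∀ y ∈ nm, ∀ w ∈ S, ⁅y, w⁆ ∈ S) → ∀ z : L, ⁅z, v⁆ ∈ S)
    (hK : ∀ y ∈ nm, ∀ w ∈ K, ⁅y, w⁆ ∈ K) : K = ⊤ := by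
  let C : Set (Submodule ℂ M) := {S | v ∈ S ∧ ∀ y ∈ nm, ∀ w ∈ S, ⁅y, w⁆ ∈ S}
  let S : Submodule ℂ M := sInf C
  have hvS : v ∈ S := by
    rw [Submodule.mem_sInf]; exact fun p hp => hp.1
  have hSn : ∀ y ∈ nm, ∀ w ∈ S, ⁅y, w⁆ ∈ S := by
    intro y hy w hw
    rw [Submodule.mem_sInf] at hw ⊢
    exact fun p hp => hp.2 y hy w (hw p hp)
  let T : Submodule ℂ M :=
    { carrier := {w | w ∈ S ∧ ∀ z : L, ⁅z, w⁆ ∈ S}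
      add_mem' := by
        rintro a b ⟨ha, ha'⟩ ⟨hb, hb'⟩
        exact ⟨S.add_mem ha hb, fun z => by rw [lie_add]; exact S.add_mem (ha' z) (hb' z)⟩
      zero_mem' := ⟨S.zero_mem, fun z => by rw [lie_zero]; exact S.zero_mem⟩
      smul_mem' := by
        rintro c a ⟨ha, ha'⟩
        exact ⟨S.smul_mem c ha, fun z => by rw [lie_smul]; exact S.smul_mem c (ha' z)⟩ }
  have hT : S ≤ T := by
    apply sInf_le
    refine ⟨⟨hvS, hv S hvS hSn⟩, ?_⟩
    rintro y hy w ⟨hw, hw'⟩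
    refine ⟨hSn y hy w hw, fun z => ?_⟩
    rw [leibniz_lie]
    exact S.add_mem (hw' _) (hSn y hy _ (hw' z))
  let N : LieSubmodule ℂ L M := { S with lie_mem := fun {z w} hw => (hT hw).2 z }
  have hN : N = ⊤ := by
    rcases hMsimple N with h | h
    · exfalso
      have : v ∈ N := hvS
      rw [h] at this
      exact hv0 (by simpa using this)
    · exact h
  have hSK : S ≤ K := sInf_le ⟨hvK, hK⟩
  rw [eq_top_iff]
  intro w _
  apply hSK
  have : w ∈ N := by rw [hN]; trivial
  exact this

end Gen
/-- For every `x ∈ V⁰` outside the union of the hyperplanes `H_μ` (i.e.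
with `e_μ·x ≠ 0` for every nonzero root vector `e_μ`, `μ` short), the stabiliser
`𝔤_x = {y : y·x = 0}` equals `𝔥 = 𝔱 ⊕ (⊕_{μ∈Δl} 𝔤^μ)`, and `𝔤·x = ⊕_{μ∈Δs} V^μ`; in
particular `V = V⁰ ⊕ 𝔤·x`. -/
theorem statement12
    {E : Type} [NormedAddCommGroup E] [InnerProductSpace ℝ E] [FiniteDimensional ℝ E]
    (Δ Δs Δl Δp Φ Φs : Set E)
    -- `Δ` is a reduced crystallographic root system in `E`
    (hfin : Δ.Finite) (h0 : (0 : E) ∉ Δ)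
    (hspan : Submodule.span ℝ Δ = ⊤)
    (hrefl : ∀ α ∈ Δ, ∀ β ∈ Δ, rrefl α β ∈ Δ)
    (hcrys : ∀ α ∈ Δ, ∀ β ∈ Δ, ∃ n : ℤ, 2 * ⟪β, α⟫ / ⟪α, α⟫ = (n : ℝ))
    (hred : ∀ α ∈ Δ, ∀ t : ℝ, t • α ∈ Δ → t = 1 ∨ t = -1)
    -- irreducible
    (hirr : ∀ A B : Set E, A ∪ B = Δ → (∀ a ∈ A, ∀ b ∈ B, ⟪a, b⟫ = 0) → A = ∅ ∨ B = ∅)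
    -- two root lengths: `Δs` are the short roots, `Δl` the long ones
    (ls ll : ℝ) (h0ls : 0 < ls) (hlsll : ls < ll)
    (hΔs : Δs = {α ∈ Δ | ‖α‖ = ls}) (hΔl : Δl = {α ∈ Δ | ‖α‖ = ll})
    (hcover : Δ = Δs ∪ Δl) (hsne : Δs.Nonempty) (hlne : Δl.Nonempty)
    -- `Δp` is a positive system with simple roots `Φ`; `Φs = Φ ∩ Δs`
    (hΔpΔ : Δp ⊆ Δ) (hpm : ∀ α ∈ Δ, α ∈ Δp ↔ -α ∉ Δp)
    (hΦp : Φ ⊆ Δp)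
    (hΦind : LinearIndependent ℝ (fun a : Φ => (a : E)))
    (hΦdec : ∀ γ ∈ Δp, ∃ c : E →₀ ℕ, ↑c.support ⊆ Φ ∧ γ = c.sum fun α n => (n : ℝ) • α)
    (hΦs : Φs = Φ ∩ Δs)
    -- `θs` is the highest short root
    (θs : E) (hθsmem : θs ∈ Δs ∩ Δp)
    (hθshigh : ∀ γ ∈ Δs, ∃ c : E →₀ ℝ, ↑c.support ⊆ Φ ∧ (∀ α, 0 ≤ c α) ∧
      θs - γ = c.sum fun α t => t • α)
    -- `L` is a complex simple Lie algebra with Cartan subalgebra `H`, whose root system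
    -- is identified with `Δ` via `e`
    (L : Type) [LieRing L] [LieAlgebra ℂ L] [FiniteDimensional ℂ L]
    [LieAlgebra.IsSimple ℂ L]
    (H : LieSubalgebra ℂ L) [H.IsCartanSubalgebra]
    (e : E → H → ℂ)
    (headd : ∀ a b : E, e (a + b) = e a + e b)
    (heinj : Function.Injective e)
    (hroots1 : ∀ μ ∈ Δ, hwt H L (e μ) ≠ ⊥)
    (hroots2 : ∀ χ : H → ℂ, χ ≠ 0 → hwt H L χ ≠ ⊥ → ∃ μ ∈ Δ, χ = e μ)
    -- `M` is the little adjoint module `V_{θs}`: the (finite-dimensional) simple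
    -- `L`-module with highest weight `θs`
    (M : Type) [AddCommGroup M] [Module ℂ M] [LieRingModule L M] [LieModule ℂ L M]
    [FiniteDimensional ℂ M] [Nontrivial M]
    (hMsimple : ∀ N : LieSubmodule ℂ L M, N = ⊥ ∨ N = ⊤)
    (hhw : ∃ v : M, v ≠ 0 ∧ v ∈ hwt H M (e θs) ∧
      ∀ γ ∈ Δp, ∀ x ∈ hwt H L (e γ), ⁅x, v⁆ = 0)
 :
    ∀ x ∈ hwt H M (0 : H → ℂ),
      (∀ μ ∈ Δs, ∀ y ∈ hwt H L (e μ), y ≠ 0 → ⁅y, x⁆ ≠ 0) →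
      LinearMap.ker (actOn L M x) = H.toSubmodule ⊔ (⨆ μ ∈ Δl, hwt H L (e μ)) ∧
      LinearMap.range (actOn L M x) = (⨆ μ ∈ Δs, hwt H M (e μ)) ∧
      IsCompl (hwt H M (0 : H → ℂ)) (LinearMap.range (actOn L M x)) := by
  intro x hx hreg
  obtain ⟨e, rfl⟩ : ∃ e' : E →+ (H → ℂ), e = e' := ⟨AddMonoidHom.mk' e headd, rfl⟩
  obtain ⟨v, hv0, hvθ, hvp⟩ := hhw
  obtain ⟨f, hf⟩ := exists_height hΦind
  have hΔsΔ : ∀ μ ∈ Δs, μ ∈ Δ ∧ ‖μ‖ = ls := by intro μ hμ; rw [hΔs] at hμ; exact hμ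
  have hΔlΔ : ∀ μ ∈ Δl, μ ∈ Δ ∧ ‖μ‖ = ll := by intro μ hμ; rw [hΔl] at hμ; exact hμ
  have hΦΔ : Φ ⊆ Δ := hΦp.trans hΔpΔ
  have hls : ∀ α ∈ Δ, ls ≤ ‖α‖ := by
    intro α hα
    rw [hcover] at hα
    rcases hα with h | h
    · exact (hΔsΔ α h).2.ge
    · rw [(hΔlΔ α h).2]; exact hlsll.le
  have hneg : ∀ α ∈ Δ, -α ∈ Δ := by
    intro α hα
    have h1 := hrefl α hα α hα
    have haa : ⟪α, α⟫ ≠ 0 := (real_inner_self_pos.2 (fun h => h0 (h ▸ hα))).ne'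
    rw [rrefl_eq, mul_div_assoc, div_self haa, mul_one, two_smul] at h1
    simpa using h1
  have he0 : ∀ μ ∈ Δ, e μ ≠ 0 := by
    intro μ hμ h
    rw [← map_zero e] at h
    exact h0 (heinj h ▸ hμ)
  have hclos : ∀ δ ∈ AddSubmonoid.closure Φ, 0 ≤ f δ ∧ (f δ = 0 → δ = 0) := by
    intro δ hδ
    induction hδ using AddSubmonoid.closure_induction with
    | mem y hy => rw [hf y hy]; simp
    | zero => simp
    | add y z _ _ hy hz =>
      refine ⟨by rw [map_add]; exact add_nonneg hy.1 hz.1, fun h => ?_⟩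
      rw [map_add] at h
      rw [hy.2 (by linarith [hy.1, hz.1]), hz.2 (by linarith [hy.1, hz.1]), add_zero]
  have hpos : ∀ γ ∈ Δp, γ ∈ AddSubmonoid.closure Φ ∧ 0 < f γ := by
    intro γ hγ
    have h1 : γ ∈ AddSubmonoid.closure Φ := by
      obtain ⟨c, hc, hsum⟩ := hΦdec γ hγ
      rw [hsum]
      refine sum_mem fun a ha => ?_
      change ((c a : ℕ) : ℝ) • a ∈ AddSubmonoid.closure Φ
      rw [Nat.cast_smul_eq_nsmul]
      exact nsmul_mem (AddSubmonoid.subset_closure (hc ha)) _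
    refine ⟨h1, lt_of_le_of_ne (hclos γ h1).1 fun h => ?_⟩
    exact h0 ((hclos γ h1).2 h.symm ▸ hΔpΔ hγ)
  -- weight spaces
  have hind : iSupIndep (fun l : E => hwt H M (e l)) :=
    (hwt_indep (H := H) (M := M)).comp heinj
  let D : Set E := {δ | δ ∈ AddSubmonoid.closure Φ ∧ 0 < f δ}
  let K1 : Submodule ℂ M := ⨆ δ ∈ D, hwt H M (e (θs - δ))
  have hK : (ℂ ∙ v) ⊔ K1 = ⊤ := by
    refine gen_top hMsimple _ {y | ∃ γ ∈ Δp, y ∈ hwt H L (e (-γ))} v hv0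
      (Submodule.mem_sup_left (Submodule.mem_span_singleton_self v)) ?_ ?_
    · intro S hvS hS z
      have hz : z ∈ ⨆ χ : H → ℂ, hwt H L χ := by rw [hwt_top]; trivial
      induction hz using Submodule.iSup_induction' with
      | zero => rw [zero_lie]; exact S.zero_mem
      | add a b _ _ ha hb => rw [add_lie]; exact S.add_mem ha hb
      | mem χ z hz =>
        by_cases hb : hwt H L χ = ⊥
        · rw [hb, Submodule.mem_bot] at hz
          rw [hz, zero_lie]; exact S.zero_mem
        by_cases hχ : χ = 0
        · rw [hχ, hwt_zero_eq] at hz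
          have h1 : ⁅z, v⁆ = e θs ⟨z, hz⟩ • v := hvθ ⟨z, hz⟩
          rw [h1]; exact S.smul_mem _ hvS
        obtain ⟨μ, hμ, rfl⟩ := hroots2 χ hχ hb
        by_cases hp : μ ∈ Δp
        · rw [hvp μ hp z hz]; exact S.zero_mem
        · have h1 : -μ ∈ Δp := by
            by_contra h
            exact hp ((hpm μ hμ).2 h)
          exact hS z ⟨-μ, h1, by rw [neg_neg]; exact hz⟩ v hvS
    · rintro y ⟨γ, hγ, hy⟩
      have hle : (ℂ ∙ v) ⊔ K1 ≤ Submodule.comap (adm L M y) K1 := by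
        refine sup_le ?_ (iSup₂_le fun δ hδ => ?_)
        · rw [Submodule.span_singleton_le_iff_mem]
          change ⁅y, v⁆ ∈ K1
          have h1 := hwt_lie hy hvθ
          rw [← map_add, neg_add_eq_sub] at h1
          exact Submodule.mem_iSup_of_mem γ (Submodule.mem_iSup_of_mem (hpos γ hγ) h1)
        · intro w hw
          change ⁅y, w⁆ ∈ K1
          have h1 := hwt_lie hy hw
          rw [← map_add, show -γ + (θs - δ) = θs - (δ + γ) by abel] at h1
          refine Submodule.mem_iSup_of_mem (δ + γ) (Submodule.mem_iSup_of_mem ?_ h1)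
          exact ⟨add_mem hδ.1 (hpos γ hγ).1, by rw [map_add]; linarith [hδ.2, (hpos γ hγ).2]⟩
      intro w hw
      exact Submodule.mem_sup_right (hle hw)
  have hspanv : (ℂ ∙ v) ≤ hwt H M (e θs) := by
    rw [Submodule.span_singleton_le_iff_mem]; exact hvθ
  have hP : ∀ l : E, hwt H M (e l) ≠ ⊥ → l = θs ∨ ∃ δ ∈ D, l = θs - δ := by
    intro l hl
    by_contra hcon
    push Not at hcon
    apply hl
    have h1 : (ℂ ∙ v) ⊔ K1 ≤ ⨆ j, ⨆ _ : j ≠ l, hwt H M (e j) := by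
      refine sup_le (hspanv.trans ?_) (iSup₂_le fun δ hδ => ?_)
      · exact le_iSup₂_of_le θs (Ne.symm hcon.1) le_rfl
      · exact le_iSup₂_of_le (θs - δ) (Ne.symm (hcon.2 δ hδ)) le_rfl
    rw [hK, top_le_iff] at h1
    have h2 := hind l
    rw [h1] at h2
    exact disjoint_top.1 h2
  have hθ1 : Module.finrank ℂ (hwt H M (e θs)) ≤ 1 := by
    refine finrank_le_one ⟨v, hvθ⟩ ?_
    rintro ⟨w, hw⟩
    have h1 : w ∈ (ℂ ∙ v) ⊔ K1 := by rw [hK]; trivial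
    obtain ⟨a, ha, u, hu, hau⟩ := Submodule.mem_sup.1 h1
    obtain ⟨c, rfl⟩ := Submodule.mem_span_singleton.1 ha
    have h2 : K1 ≤ ⨆ j, ⨆ _ : j ≠ θs, hwt H M (e j) := by
      refine iSup₂_le fun δ hδ => le_iSup₂_of_le (θs - δ) ?_ le_rfl
      intro h
      have h3 : δ = 0 := by simpa using h
      have h4 := hδ.2
      rw [h3, map_zero] at h4
      exact lt_irrefl _ h4
    have h3 : u ∈ hwt H M (e θs) := by
      have : u = w - c • v := by rw [← hau]; abel
      rw [this]
      exact Submodule.sub_mem _ hw (Submodule.smul_mem _ c hvθ)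
    have h4 : u = 0 := Submodule.disjoint_def.1 (hind θs) u h3 (h2 hu)
    refine ⟨c, Subtype.ext ?_⟩
    change c • v = w
    rw [← hau, h4, add_zero]
  have hd0 : ∀ l : E, Module.finrank ℂ (hwt H M (e l)) ≠ 0 ↔ hwt H M (e l) ≠ ⊥ := by
    intro l
    rw [Ne, Submodule.finrank_eq_zero]
  have hclosneg : ∀ δ ∈ AddSubmonoid.closure Φ, -δ ∈ AddSubmonoid.closure Δ := by
    intro δ hδ
    induction hδ using AddSubmonoid.closure_induction with
    | mem y hy => exact AddSubmonoid.subset_closure (hneg y (hΦΔ hy))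
    | zero => simp
    | add y z _ _ hy hz => rw [neg_add]; exact add_mem hy hz
  have hθΔ : θs ∈ Δ := hΔpΔ hθsmem.2
  have hclosin : ∀ μ : E, (∀ α ∈ Φ, 0 ≤ ⟪μ, α⟫) → ∀ δ ∈ AddSubmonoid.closure Φ, 0 ≤ ⟪μ, δ⟫ := by
    intro μ hμ δ hδ
    induction hδ using AddSubmonoid.closure_induction with
    | mem y hy => exact hμ y hy
    | zero => simp
    | add y z _ _ hy hz => rw [inner_add_right]; exact add_nonneg hy hz
  obtain ⟨hW, hW1⟩ := core hfin h0 hrefl hcrys hΦΔ f hf ls h0ls hls θs (hΔsΔ θs hθsmem.1).2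
    (by
      intro γ hγ hγn μ hμ
      obtain ⟨c, hc, hc0, hsum⟩ := hθshigh γ (by rw [hΔs]; exact ⟨hγ, hγn⟩)
      rw [hsum, Finsupp.sum, inner_sum]
      refine Finset.sum_nonneg fun a ha => ?_
      rw [real_inner_smul_right]
      exact mul_nonneg (hc0 a) (hμ a (hc ha)))
    (fun l => Module.finrank ℂ (hwt H M (e l)))
    (by
      simp only [hd0]
      exact WellFoundedGT.finite_ne_bot_of_iSupIndep hind)
    (by
      intro l hl
      rcases hP l ((hd0 l).1 hl) with rfl | ⟨δ, hδ, rfl⟩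
      · exact AddSubmonoid.subset_closure hθΔ
      · rw [sub_eq_add_neg]
        exact add_mem (AddSubmonoid.subset_closure hθΔ) (hclosneg δ hδ.1))
    (by
      intro l hl μ hμ
      rcases hP l ((hd0 l).1 hl) with rfl | ⟨δ, hδ, rfl⟩
      · simp
      · rw [sub_sub_cancel]; exact hclosin μ hμ δ hδ.1)
    (by
      intro α hα l hl hla n hn
      have hαΔ := hΦΔ hα
      obtain ⟨c, X, hX, Y, hY, t, hac, hc⟩ := hwt_sl2 (he0 α hαΔ) (hroots1 α hαΔ)
      have hpair := pair_match hfin h0 hrefl hcrys e α hαΔ c hac (by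
        intro β hβ
        obtain ⟨m, hm, hm1, hm2⟩ := hc (e β) (he0 β hβ) (hroots1 β hβ)
        refine ⟨m, hm, ?_⟩
        obtain ⟨ν, hν, hν'⟩ := hroots2 _ hm2 hm1
        rw [← map_zsmul, ← map_sub] at hν'
        rw [heinj hν']; exact hν) l hl
      rw [hn] at hpair
      have hmaps : ∀ k : ℕ, ∀ w ∈ hwt H M (e l),
          ((LieModule.toEnd ℂ L M X) ^ k) w ∈ hwt H M (e (l + (k : ℝ) • α)) := by
        intro k w hw
        induction k with
        | zero => simpa using hw
        | succ k ih =>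
          rw [pow_succ', Module.End.mul_apply, LieModule.toEnd_apply_apply]
          have h1 := hwt_lie hX ih
          rw [← map_add] at h1
          convert h1 using 3
          push_cast
          rw [add_smul, one_smul]; abel
      refine LinearMap.finrank_le_finrank_of_injective
        (f := LinearMap.restrict ((LieModule.toEnd ℂ L M X) ^ n) (hmaps n)) ?_
      rw [injective_iff_map_eq_zero]
      rintro ⟨w, hw⟩ hw0
      by_contra hne
      have hw1 : w ≠ 0 := fun h => hne (Subtype.ext h)
      refine sl2_inj t hw1 n ?_ ?_ (congrArg Subtype.val hw0)
      · have h1 : ⁅(c : L), w⁆ = e l c • w := hw c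
        rw [h1, hpair]; push_cast; rfl
      · have h1 := hwt_lie hY hw
        rw [← map_neg, ← map_add, neg_add_eq_sub, Submodule.finrank_eq_zero.1 hla] at h1
        simpa using h1)
    hθ1
  have hlong : ∀ μ ∈ Δl, hwt H M (e μ) = ⊥ := by
    intro μ hμ
    by_contra h
    have h1 := hΔlΔ μ hμ
    rcases hW μ ((hd0 μ).2 h) with h2 | h2
    · exact h0 (h2 ▸ h1.1)
    · linarith [h1.2, h2.2]
  have hact : ∀ χ : H → ℂ, ∀ y ∈ hwt H L χ, ⁅y, x⁆ ∈ hwt H M χ := by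
    intro χ y hy
    have := hwt_lie hy hx
    rwa [add_zero] at this
  have hact0 : ∀ y ∈ H.toSubmodule, ⁅y, x⁆ = 0 := by
    intro y hy
    have h1 : ⁅y, x⁆ = (0 : ℂ) • x := hx ⟨y, hy⟩
    rw [h1, zero_smul]
  have hLtop : (H.toSubmodule ⊔ (⨆ μ ∈ Δl, hwt H L (e μ))) ⊔ (⨆ μ ∈ Δs, hwt H L (e μ)) = ⊤ := by
    rw [eq_top_iff, ← hwt_top (H := H)]
    refine iSup_le fun χ => ?_
    by_cases hb : hwt H L χ = ⊥
    · rw [hb]; exact bot_le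
    by_cases hχ : χ = 0
    · rw [hχ, hwt_zero_eq]; exact le_sup_of_le_left le_sup_left
    obtain ⟨μ, hμ, rfl⟩ := hroots2 χ hχ hb
    rw [hcover] at hμ
    rcases hμ with h | h
    · exact le_sup_of_le_right (le_iSup₂_of_le μ h le_rfl)
    · exact le_sup_of_le_left (le_sup_of_le_right (le_iSup₂_of_le μ h le_rfl))
  have hkle : H.toSubmodule ⊔ (⨆ μ ∈ Δl, hwt H L (e μ)) ≤ LinearMap.ker (actOn L M x) := by
    refine sup_le (fun y hy => hact0 y hy) (iSup₂_le fun μ hμ y hy => ?_)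
    have h1 := hact _ y hy
    rw [hlong μ hμ, Submodule.mem_bot] at h1
    exact h1
  have hrange : LinearMap.range (actOn L M x) = (⨆ μ ∈ Δs, hwt H M (e μ)) := by
    apply le_antisymm
    · rw [LinearMap.range_eq_map, ← hLtop, Submodule.map_sup]
      refine sup_le ?_ ?_
      · rw [Submodule.map_le_iff_le_comap]
        intro y hy
        have h1 : actOn L M x y = 0 := hkle hy
        rw [Submodule.mem_comap, h1]; exact Submodule.zero_mem _
      · rw [Submodule.map_le_iff_le_comap]
        refine iSup₂_le fun μ hμ y hy => ?_
        exact Submodule.mem_iSup_of_mem μ (Submodule.mem_iSup_of_mem hμ (hact _ y hy))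
    · refine iSup₂_le fun μ hμ w hw => ?_
      obtain ⟨hμΔ, hμn⟩ := hΔsΔ μ hμ
      obtain ⟨y, hy, hy0⟩ := Submodule.exists_mem_ne_zero_of_ne_bot (hroots1 μ hμΔ)
      have hyx := hreg μ hμ y hy hy0
      have hyx' := hact _ y hy
      let u : hwt H M (e μ) := ⟨⁅y, x⁆, hyx'⟩
      have hu : u ≠ 0 := fun h => hyx (congrArg Subtype.val h)
      have h1 : Module.finrank ℂ (hwt H M (e μ)) = 1 := by
        apply le_antisymm (hW1 μ hμΔ hμn)
        rw [Nat.one_le_iff_ne_zero, hd0]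
        exact Submodule.ne_bot_iff _ |>.2 ⟨_, hyx', hyx⟩
      obtain ⟨c, hc⟩ := (finrank_eq_one_iff_of_nonzero' u hu).1 h1 ⟨w, hw⟩
      refine ⟨c • y, ?_⟩
      change ⁅c • y, x⁆ = w
      rw [smul_lie]
      exact congrArg Subtype.val hc
  refine ⟨le_antisymm ?_ hkle, hrange, ?_⟩
  · intro z hz
    have hz1 : z ∈ (⊤ : Submodule ℂ L) := trivial
    rw [← hLtop] at hz1
    obtain ⟨a, ha, s, hs, rfl⟩ := Submodule.mem_sup.1 hz1
    have hs0 : actOn L M x s = 0 := by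
      have h1 : actOn L M x a = 0 := hkle ha
      have h2 : actOn L M x (a + s) = 0 := hz
      rwa [map_add, h1, zero_add] at h2
    rw [iSup_subtype', Submodule.mem_iSup_iff_exists_finsupp] at hs
    obtain ⟨g, hg, hgs⟩ := hs
    have hind' : iSupIndep (fun μ : Δs => hwt H M (e μ)) := hind.comp Subtype.val_injective
    rw [iSupIndep_iff_finsetSum_eq_zero_imp_eq_zero] at hind'
    have h3 : ∑ i ∈ g.support, ⁅g i, x⁆ = 0 := by
      rw [← hs0, ← hgs, Finsupp.sum, map_sum]; rfl
    have h4 := hind' g.support (fun i => ⁅g i, x⁆) (fun i _ => hact _ _ (hg i)) h3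
    have hgz : g = 0 := by
      by_contra hne
      obtain ⟨i, hi⟩ := Finsupp.support_nonempty_iff.2 hne
      exact hreg i i.2 (g i) (hg i) (Finsupp.mem_support_iff.1 hi) (h4 i hi)
    rw [← hgs, hgz, Finsupp.sum_zero_index, add_zero]
    exact ha
  · rw [hrange]
    have hz : hwt H M (0 : H → ℂ) = hwt H M (e 0) := by rw [map_zero]
    rw [hz]
    constructor
    · refine (hind 0).mono_right (iSup₂_le fun μ hμ => le_iSup₂_of_le μ ?_ le_rfl)
      rintro rfl
      exact h0 (hΔsΔ _ hμ).1
    · rw [codisjoint_iff, eq_top_iff, ← hK]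
      have h1 : ∀ l : E, hwt H M (e l) ≤ hwt H M (e 0) ⊔ ⨆ μ ∈ Δs, hwt H M (e μ) := by
        intro l
        by_cases hb : hwt H M (e l) = ⊥
        · rw [hb]; exact bot_le
        rcases hW l ((hd0 l).2 hb) with rfl | h
        · exact le_sup_left
        · exact le_sup_of_le_right (le_iSup₂_of_le l (by rw [hΔs]; exact h) le_rfl)
      exact sup_le (hspanv.trans (h1 _)) (iSup₂_le fun δ _ => h1 _)
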